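/- Let D be a metric on ℕ (with 0 playing the role of the root). Suppose that for every n ≥ 1 there exist an R-tree (R_n, d_n) and points x_0^n, x_1^n, …, x_n^n ∈ R_n such that d_n(x_i^n, x_j^n) = D(i,j) for all 0 ≤ i, j ≤ n and R_n = ⋃_{1≤i≤n} [[x_0^n, x_i^n]]. Then there exist an R-tree (R, d_R) and points (x_i)_{i∈ℕ} ⊆ R with d_R(x_i, x_j) = D(i,j) for all i, j ∈ ℕ and R = ⋃_{i≥1} [[x_0, x_i]]. -/

import Mathlib

open Set

/-- `f` parametrizes the geodesic from `u` to `v` by arclength: it is an isometry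
of `[0, d(u,v)]` into the space, sending `0` to `u` and `d(u,v)` to `v`. -/
def IsSegParam {T : Type*} [MetricSpace T] (u v : T) (f : ℝ → T) : Prop :=
  f 0 = u ∧ f (dist u v) = v ∧
    ∀ s ∈ Icc (0 : ℝ) (dist u v), ∀ t ∈ Icc (0 : ℝ) (dist u v),
      dist (f s) (f t) = |s - t|

/-- The segment `[[u,v]]`: the image of `[0, d(u,v)]` under any arclength
parametrization of the geodesic from `u` to `v`. -/
def rSeg {T : Type*} [MetricSpace T] (u v : T) : Set T :=
  {x | ∃ f, IsSegParam u v f ∧ x ∈ f '' Icc (0 : ℝ) (dist u v)}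

/-- A metric space is an `ℝ`-tree if every pair of points is joined by a unique
arclength-parametrized geodesic, and every continuous injective arc between two
points has image equal to the segment `[[u,v]]` between them. -/
structure IsRTree (T : Type*) [MetricSpace T] : Prop where
  exists_param : ∀ u v : T, ∃ f, IsSegParam u v f
  param_unique : ∀ (u v : T) (f g : ℝ → T), IsSegParam u v f → IsSegParam u v g →
    EqOn f g (Icc 0 (dist u v))
  arc_eq_seg : ∀ (u v : T) (g : ℝ → T), ContinuousOn g (Icc 0 1) → InjOn g (Icc 0 1) →
    g 0 = u → g 1 = v → g '' Icc 0 1 = rSeg u v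

namespace IsSegParam

variable {T : Type*} [MetricSpace T] {u v : T} {f : ℝ → T}

theorem dist_left (hf : IsSegParam u v f) {t : ℝ} (ht : t ∈ Icc 0 (dist u v)) :
    dist u (f t) = t := by
  have h := hf.2.2 0 ⟨le_rfl, dist_nonneg⟩ t ht
  rw [hf.1, zero_sub, abs_neg, abs_of_nonneg ht.1] at h
  exact h

theorem dist_right (hf : IsSegParam u v f) {t : ℝ} (ht : t ∈ Icc 0 (dist u v)) :
    dist (f t) v = dist u v - t := by
  have h := hf.2.2 t ht (dist u v) ⟨dist_nonneg, le_rfl⟩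
  rw [hf.2.1, abs_sub_comm, abs_of_nonneg (sub_nonneg.2 ht.2)] at h
  exact h

theorem continuousOn (hf : IsSegParam u v f) : ContinuousOn f (Icc 0 (dist u v)) := by
  refine (LipschitzOnWith.of_dist_le_mul (K := 1) fun s hs t ht => ?_).continuousOn
  rw [hf.2.2 s hs t ht, Real.dist_eq, NNReal.coe_one, one_mul]

theorem restrict_right (hf : IsSegParam u v f) {t : ℝ} (ht : t ∈ Icc 0 (dist u v)) :
    IsSegParam (f t) v fun s => f (t + s) := by
  refine ⟨by simp, ?_, fun a ha b hb => ?_⟩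
  · simp only [hf.dist_right ht, add_sub_cancel, hf.2.1]
  · rw [hf.dist_right ht] at ha hb
    rw [hf.2.2 _ ⟨by linarith [ha.1, ht.1], by linarith [ha.2]⟩ _
      ⟨by linarith [hb.1, ht.1], by linarith [hb.2]⟩]
    congr 1; ring

theorem restrict_left (hf : IsSegParam u v f) {t : ℝ} (ht : t ∈ Icc 0 (dist u v)) :
    IsSegParam (f t) u fun s => f (t - s) := by
  have hd : dist (f t) u = t := by rw [dist_comm, hf.dist_left ht]
  refine ⟨by simp, ?_, fun a ha b hb => ?_⟩
  · simp only [hd, sub_self, hf.1]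
  · rw [hd] at ha hb
    rw [hf.2.2 _ ⟨by linarith [ha.2], by linarith [ha.1, ht.2]⟩ _
      ⟨by linarith [hb.2], by linarith [hb.1, ht.2]⟩, abs_sub_comm]
    congr 1; ring

end IsSegParam

theorem dist_add_dist_of_mem_rSeg {T : Type*} [MetricSpace T] {u v x : T} (hx : x ∈ rSeg u v) :
    dist u x + dist x v = dist u v := by
  obtain ⟨f, hf, t, ht, rfl⟩ := hx
  rw [hf.dist_left ht, hf.dist_right ht]
  ring

/-- Two geodesics of an `ℝ`-tree that meet only at their common endpoint concatenate to a
geodesic. -/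
theorem IsRTree.dist_add_dist_of_segments {T : Type*} [MetricSpace T] (hT : IsRTree T)
    {a p b : T} {f g : ℝ → T} (hf : IsSegParam a p f) (hg : IsSegParam p b g)
    (hfg : ∀ s ∈ Icc 0 (dist a p), ∀ t ∈ Icc 0 (dist p b), f s = g t → f s = p) :
    dist a p + dist p b = dist a b := by
  set α := dist a p with hα
  set β := dist p b with hβ
  have hα0 : 0 ≤ α := dist_nonneg
  have hβ0 : 0 ≤ β := dist_nonneg
  rcases (add_nonneg hα0 hβ0).eq_or_lt with h0 | hc
  · linarith [dist_triangle a p b, dist_nonneg (x := a) (y := b)]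
  set c := α + β with hcdef
  let h : ℝ → T := fun t => if t * c ≤ α then f (t * c) else g (t * c - α)
  have hmemf : ∀ {t}, t ∈ Icc (0 : ℝ) 1 → t * c ≤ α → t * c ∈ Icc 0 α := fun ht h' =>
    ⟨mul_nonneg ht.1 hc.le, h'⟩
  have hmemg : ∀ {t}, t ∈ Icc (0 : ℝ) 1 → ¬ t * c ≤ α → t * c - α ∈ Icc 0 β := fun ht h' =>
    ⟨by linarith, by nlinarith [ht.2]⟩
  have hcross : ∀ s ∈ Icc (0 : ℝ) 1, ∀ t ∈ Icc (0 : ℝ) 1, s * c ≤ α → ¬ t * c ≤ α →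
      dist (f (s * c)) (g (t * c - α)) ≤ t * c - s * c := by
    intro s hs t ht h1 h2
    have := dist_triangle (f (s * c)) p (g (t * c - α))
    rw [hf.dist_right (hmemf hs h1), hg.dist_left (hmemg ht h2)] at this
    linarith
  have hcross' : ∀ s ∈ Icc (0 : ℝ) 1, ∀ t ∈ Icc (0 : ℝ) 1, s * c ≤ α → ¬ t * c ≤ α →
      f (s * c) ≠ g (t * c - α) := by
    intro s hs t ht h1 h2 he
    have h3 := hfg _ (hmemf hs h1) _ (hmemg ht h2) he
    have h4 := hg.dist_left (hmemg ht h2)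
    rw [← he, h3, dist_self] at h4
    exact h2 (by linarith)
  have hlip : LipschitzOnWith (Real.toNNReal c) h (Icc 0 1) := by
    refine LipschitzOnWith.of_dist_le_mul fun s hs t ht => ?_
    rw [Real.coe_toNNReal _ hc.le, Real.dist_eq]
    have e : c * |s - t| = |s * c - t * c| := by
      rw [← sub_mul, abs_mul, abs_of_pos hc, mul_comm]
    rw [e]
    by_cases h1 : s * c ≤ α <;> by_cases h2 : t * c ≤ α <;> simp only [h, h1, h2, if_true, if_false]
    · exact (hf.2.2 _ (hmemf hs h1) _ (hmemf ht h2)).le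
    · exact (hcross s hs t ht h1 h2).trans (by rw [abs_sub_comm]; exact le_abs_self _)
    · rw [dist_comm]
      exact (hcross t ht s hs h2 h1).trans (le_abs_self _)
    · rw [hg.2.2 _ (hmemg hs h1) _ (hmemg ht h2), sub_sub_sub_cancel_right]
  have hinj : InjOn h (Icc 0 1) := by
    intro s hs t ht hst
    have key : s * c = t * c → s = t := fun h' => mul_right_cancel₀ hc.ne' h'
    by_cases h1 : s * c ≤ α <;> by_cases h2 : t * c ≤ α <;>
      simp only [h, h1, h2, if_true, if_false] at hst
    · have := hf.2.2 _ (hmemf hs h1) _ (hmemf ht h2)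
      rw [hst, dist_self, eq_comm, abs_eq_zero] at this
      exact key (by linarith)
    · exact absurd hst (hcross' s hs t ht h1 h2)
    · exact absurd hst.symm (hcross' t ht s hs h2 h1)
    · have := hg.2.2 _ (hmemg hs h1) _ (hmemg ht h2)
      rw [hst, dist_self, eq_comm, abs_eq_zero] at this
      exact key (by linarith)
  have h0 : h 0 = a := by simp [h, hα0, hf.1]
  have h1 : h 1 = b := by
    simp only [h, one_mul]
    split_ifs with h'
    · have hβ' : β = 0 := by linarith
      have : c = α := by linarith
      rw [this, hf.2.1]
      exact dist_eq_zero.1 hβ'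
    · rw [hcdef, add_sub_cancel_left, hg.2.1]
  have hp : p ∈ h '' Icc 0 1 := by
    refine ⟨α / c, ⟨by positivity, (div_le_one hc).2 (by linarith)⟩, ?_⟩
    simp only [h, div_mul_cancel₀ _ hc.ne', le_refl, if_true, hα, hf.2.1]
  rw [hT.arc_eq_seg a b h hlip.continuousOn hinj h0 h1] at hp
  exact dist_add_dist_of_mem_rSeg hp

/-- Every point of an `ℝ`-tree has a projection on every geodesic. -/
theorem IsRTree.exists_projection {T : Type*} [MetricSpace T] (hT : IsRTree T) (r : T)
    {x y : T} {f : ℝ → T} (hf : IsSegParam x y f) :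
    ∃ t ∈ Icc 0 (dist x y), dist r (f t) + dist (f t) x = dist r x ∧
      dist r (f t) + dist (f t) y = dist r y := by
  obtain ⟨t, ht, hmin⟩ := isCompact_Icc.exists_isMinOn
    (nonempty_Icc.2 (dist_nonneg (x := x) (y := y)))
    (f := fun t => dist r (f t)) (continuous_const.dist continuous_id |>.comp_continuousOn hf.continuousOn)
  obtain ⟨g, hg⟩ := hT.exists_param r (f t)
  have key : ∀ s ∈ Icc 0 (dist r (f t)), ∀ τ ∈ Icc 0 (dist x y), g s = f τ → g s = f t := by
    intro s hs τ hτ he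
    have h1 : dist r (f t) ≤ dist r (f τ) := hmin hτ
    rw [← he, hg.dist_left hs] at h1
    rw [le_antisymm hs.2 h1, hg.2.1]
  refine ⟨t, ht, hT.dist_add_dist_of_segments hg (hf.restrict_left ht) ?_,
    hT.dist_add_dist_of_segments hg (hf.restrict_right ht) ?_⟩
  · intro s hs τ hτ he
    rw [dist_comm, hf.dist_left ht] at hτ
    exact key s hs (t - τ) ⟨by linarith [hτ.2], by linarith [hτ.1, ht.2]⟩ he
  · intro s hs τ hτ he
    rw [hf.dist_right ht] at hτ
    exact key s hs (t + τ) ⟨by linarith [hτ.1, ht.1], by linarith [hτ.2]⟩ he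

theorem IsRTree.eq_of_dist_add_dist {T : Type*} [MetricSpace T] (hT : IsRTree T)
    {x y p : T} {f : ℝ → T} (hf : IsSegParam x y f) (hp : dist x p + dist p y = dist x y) :
    p = f (dist x p) := by
  obtain ⟨t, ht, h1, h2⟩ := hT.exists_projection p hf
  have h3 := hf.dist_left ht
  have h4 := hf.dist_right ht
  have h0 : dist p (f t) = 0 := by
    rw [dist_comm (f t) x] at h1
    rw [dist_comm x p] at hp
    linarith
  have h5 := dist_eq_zero.1 h0
  rw [h5, h3]

/-- An `ℝ`-tree is `0`-hyperbolic, in terms of (twice) the Gromov products based at `r`. -/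
theorem IsRTree.min_gromovProduct_le {T : Type*} [MetricSpace T] (hT : IsRTree T) (r x y z : T) :
    min (dist r x + dist r y - dist x y) (dist r y + dist r z - dist y z) ≤
      dist r x + dist r z - dist x z := by
  obtain ⟨f, hf⟩ := hT.exists_param r y
  obtain ⟨a, ha⟩ := hT.exists_param x y
  obtain ⟨b, hb⟩ := hT.exists_param y z
  obtain ⟨s, hs, hs1, hs2⟩ := hT.exists_projection r ha
  obtain ⟨t, ht, ht1, ht2⟩ := hT.exists_projection r hb
  have e1 := hT.eq_of_dist_add_dist hf hs2
  have e2 := hT.eq_of_dist_add_dist hf ht1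
  have hpq : dist (a s) (b t) = |dist r (a s) - dist r (b t)| := by
    have := hf.2.2 (dist r (a s)) ⟨dist_nonneg, by linarith [dist_nonneg (x := a s) (y := y)]⟩
      (dist r (b t)) ⟨dist_nonneg, by linarith [dist_nonneg (x := b t) (y := y)]⟩
    rwa [← e1, ← e2] at this
  have a1 := ha.dist_left hs
  have a2 := ha.dist_right hs
  have b1 := hb.dist_left ht
  have b2 := hb.dist_right ht
  rw [dist_comm x] at a1
  rw [dist_comm y] at b1
  have h1 := dist_triangle x (a s) z
  have h2 := dist_triangle (a s) (b t) z
  rw [dist_comm x (a s)] at h1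
  rcases le_total (dist r (a s)) (dist r (b t)) with h | h
  · rw [abs_of_nonpos (by linarith)] at hpq
    exact min_le_of_left_le (by linarith)
  · rw [abs_of_nonneg (by linarith)] at hpq
    exact min_le_of_right_le (by linarith)

/-- In a space with the four-point property, a path from `g a` to `g b` passes through every
point metrically between its endpoints. -/
theorem mem_image_Icc_of_dist_add_dist {T : Type*} [MetricSpace T]
    (h4 : ∀ x y z w : T, dist x y + dist z w ≤ max (dist x z + dist y w) (dist x w + dist y z))
    {a b : ℝ} (hab : a ≤ b) {g : ℝ → T} (hg : ContinuousOn g (Icc a b)) {p : T}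
    (hp : dist (g a) p + dist p (g b) = dist (g a) (g b)) : p ∈ g '' Icc a b := by
  by_contra hpg
  have hconn : IsPreconnected (g '' Icc a b) := isPreconnected_Icc.image g hg
  have hne : ∀ x ∈ g '' Icc a b, x ≠ p := fun x hx h => hpg (h ▸ hx)
  have ha : g a ∈ g '' Icc a b := mem_image_of_mem g (left_mem_Icc.2 hab)
  have hb : g b ∈ g '' Icc a b := mem_image_of_mem g (right_mem_Icc.2 hab)
  let U : Set T := {x | 0 < dist (g a) p + dist p x - dist (g a) x}
  let V : Set T := {x | x ≠ p ∧ dist (g a) p + dist p x - dist (g a) x ≤ 0}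
  have hU : IsOpen U := isOpen_lt continuous_const (by fun_prop)
  have hV : IsOpen V := by
    refine Metric.isOpen_iff.2 fun x hx => ⟨dist p x, dist_pos.2 hx.1.symm, fun y hy => ?_⟩
    rw [Metric.mem_ball, dist_comm] at hy
    refine ⟨fun h => by rw [h, dist_comm x] at hy; exact lt_irrefl _ hy, ?_⟩
    have hx2 := hx.2
    by_contra! hlt
    rcases le_max_iff.1 (h4 (g a) x p y) with h | h
    · linarith [dist_pos.2 (hne _ ha), dist_nonneg (x := p) (y := y)]
    · rw [dist_comm x p] at h
      linarith
  obtain ⟨x, -, hx1, hx2⟩ := hconn U V hU hV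
    (fun x hx => (lt_or_ge 0 (dist (g a) p + dist p x - dist (g a) x)).imp id
      fun h => ⟨hne x hx, h⟩)
    ⟨g a, ha, by
      have := dist_pos.2 (hne _ ha)
      simp only [U, mem_ofPred_eq, dist_self, dist_comm p (g a)]
      linarith⟩
    ⟨g b, hb, hne _ hb, by linarith⟩
  exact absurd hx1 (not_lt.2 hx2.2)

/-- A geodesic metric space with the four-point property is an `ℝ`-tree. -/
theorem isRTree_of_fourPoint {T : Type*} [MetricSpace T]
    (hgeo : ∀ u v : T, ∃ f, IsSegParam u v f)
    (h4 : ∀ x y z w : T, dist x y + dist z w ≤ max (dist x z + dist y w) (dist x w + dist y z)) :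
    IsRTree T where
  exists_param := hgeo
  param_unique u v f g hf hg t ht := by
    have hf1 := hf.dist_left ht
    have hf2 := hf.dist_right ht
    have hg1 := hg.dist_left ht
    have hg2 := hg.dist_right ht
    have h := h4 (f t) (g t) u v
    rw [dist_comm (f t) u, dist_comm (g t) u, hf1, hf2, hg1, hg2] at h
    refine dist_le_zero.1 ?_
    rcases le_max_iff.1 h with h | h <;> linarith
  arc_eq_seg u v g hg hinj h0 h1 := by
    obtain ⟨f, hf⟩ := hgeo u v
    apply Subset.antisymm
    · rintro _ ⟨t, ht, rfl⟩
      set x := g t with hx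
      set s := (dist u x + dist u v - dist x v) / 2 with hs
      have hsmem : s ∈ Icc 0 (dist u v) := by
        have i1 := dist_triangle x u v
        have i2 := dist_triangle u v x
        rw [dist_comm x u] at i1
        rw [dist_comm v x] at i2
        constructor
        · linarith [dist_triangle x u v]
        · linarith
      have f1 := hf.dist_left hsmem
      have f2 := hf.dist_right hsmem
      have hproj : dist (f s) x ≤ (dist u x + dist x v - dist u v) / 2 := by
        have h := h4 (f s) x u v
        rw [dist_comm (f s) u, dist_comm x u, f1, f2] at h
        rcases le_max_iff.1 h with h | h <;> linarith
      have hl : f s ∈ g '' Icc 0 t := by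
        refine mem_image_Icc_of_dist_add_dist h4 ht.1
          (hg.mono (Icc_subset_Icc_right ht.2)) ?_
        rw [h0]
        linarith [dist_triangle u (f s) x]
      have hr : f s ∈ g '' Icc t 1 := by
        refine mem_image_Icc_of_dist_add_dist h4 ht.2
          (hg.mono (Icc_subset_Icc_left ht.1)) ?_
        rw [h1, dist_comm _ (f s)]
        have := dist_triangle x (f s) v
        rw [dist_comm x (f s)] at this
        linarith
      obtain ⟨c, hc, hc'⟩ := hl
      obtain ⟨d, hd, hd'⟩ := hr
      have hcd : c = d := hinj ⟨hc.1, hc.2.trans ht.2⟩ ⟨ht.1.trans hd.1, hd.2⟩ (hc'.trans hd'.symm)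
      have hct : c = t := le_antisymm hc.2 (hcd ▸ hd.1)
      exact ⟨f, hf, s, hsmem, by rw [← hc', hct]⟩
    · intro x hx
      refine mem_image_Icc_of_dist_add_dist h4 zero_le_one hg ?_
      rw [h0, h1]
      exact dist_add_dist_of_mem_rSeg hx

/-- The metric identification of a pseudo-distance. -/
theorem exists_metricSpace_of_pseudoDist.{u} {P : Type u} (d : P → P → ℝ) (hself : ∀ x, d x x = 0)
    (hcomm : ∀ x y, d x y = d y x) (htri : ∀ x y z, d x z ≤ d x y + d y z) :
    ∃ (Q : Type u) (_ : MetricSpace Q) (π : P → Q), Function.Surjective π ∧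
      ∀ x y, dist (π x) (π y) = d x y := by
  let _ : PseudoMetricSpace P :=
    { dist := d
      dist_self := hself
      dist_comm := hcomm
      dist_triangle := htri }
  exact ⟨SeparationQuotient P, inferInstance, SeparationQuotient.mk,
    SeparationQuotient.surjective_mk, SeparationQuotient.dist_mk⟩

theorem add_sub_two_mul_min (a b : ℝ) : a + b - 2 * min a b = |a - b| := by
  rcases le_total a b with h | h
  · rw [min_eq_left h, abs_of_nonpos (sub_nonpos.2 h)]
    ring
  · rw [min_eq_right h, abs_of_nonneg (sub_nonneg.2 h)]
    ring

/-- The four-point property for a kernel satisfying the strong triangle inequality. -/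
theorem min_add_le_of_ultrametric {P : Type*} {K : P → P → ℝ} (hcomm : ∀ x y, K x y = K y x)
    (hK : ∀ x y z, min (K x y) (K y z) ≤ K x z) (x y z w : P) :
    min (K x z + K y w) (K x w + K y z) ≤ K x y + K z w := by
  have h1 := hK x z y
  have h2 := hK x w y
  have h3 := hK z x w
  have h4 := hK z y w
  have h5 := hK x y z
  have h6 := hK x y w
  have h7 := hK x z w
  have h8 := hK x w z
  have h9 := hK y z w
  have h10 := hK y w z
  have h11 := hK y x z
  have h12 := hK y x w
  rw [hcomm z y] at *
  rw [hcomm w y] at *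
  rw [hcomm z x] at *
  rw [hcomm w z] at *
  rw [hcomm y x] at *
  by_contra! hcon
  obtain ⟨c1, c2⟩ := lt_min_iff.1 hcon
  grind

/-- The tree obtained by gluing segments `[0, ℓ i]` along their initial parts of length `G i j`. -/
theorem exists_glued_segments.{u} {ι : Type u} (ℓ : ι → ℝ) (G : ι → ι → ℝ) (hℓ : ∀ i, 0 ≤ ℓ i)
    (hG0 : ∀ i j, 0 ≤ G i j) (hGself : ∀ i, G i i = ℓ i) (hGcomm : ∀ i j, G i j = G j i)
    (hG : ∀ i j k, min (G i j) (G j k) ≤ G i k) :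
    ∃ (R : Type u) (_ : MetricSpace R) (γ : ι → ℝ → R), IsRTree R ∧
      (∀ x, ∃ i, ∃ s ∈ Icc 0 (ℓ i), γ i s = x) ∧
      ∀ i, ∀ s ∈ Icc 0 (ℓ i), ∀ j, ∀ t ∈ Icc 0 (ℓ j),
        dist (γ i s) (γ j t) = s + t - 2 * min (min s t) (G i j) := by
  let P := Σ i, Icc 0 (ℓ i)
  let K : P → P → ℝ := fun a b => min (min a.2.1 b.2.1) (G a.1 b.1)
  have hKcomm : ∀ a b, K a b = K b a := fun a b => by
    simp only [K, min_comm a.2.1, hGcomm a.1]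
  have hK : ∀ a b c, min (K a b) (K b c) ≤ K a c := fun a b c => by
    refine le_min (le_min ?_ ?_) (le_trans (min_le_min ?_ ?_) (hG a.1 b.1 c.1))
    · exact (min_le_left _ _).trans ((min_le_left _ _).trans (min_le_left _ _))
    · exact (min_le_right _ _).trans ((min_le_left _ _).trans (min_le_right _ _))
    · exact min_le_right _ _
    · exact min_le_right _ _
  have hKself : ∀ a, K a a = a.2.1 := fun a => by
    simp [K, hGself, a.2.2.2]
  have hKle : ∀ a b, K a b ≤ a.2.1 := fun a b => (min_le_left _ _).trans (min_le_left _ _)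
  obtain ⟨R, _, π, hπ, hd⟩ := exists_metricSpace_of_pseudoDist
    (fun a b : P => a.2.1 + b.2.1 - 2 * K a b)
    (fun a => by rw [hKself]; ring) (fun a b => by rw [hKcomm, add_comm])
    (fun a b c => by
      have h1 := hKle b a
      have h2 := hKle b c
      rw [hKcomm] at h1
      rcases min_le_iff.1 (hK a b c) with h | h <;> linarith)
  let γ : ι → ℝ → R := fun i s => π ⟨i, projIcc 0 (ℓ i) (hℓ i) s⟩
  have hγ : ∀ i, ∀ s ∈ Icc 0 (ℓ i), ∀ j, ∀ t ∈ Icc 0 (ℓ j),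
      dist (γ i s) (γ j t) = s + t - 2 * min (min s t) (G i j) := by
    intro i s hs j t ht
    simp only [γ, hd, projIcc_of_mem _ hs, projIcc_of_mem _ ht, K]
  have hsurj : ∀ x, ∃ i, ∃ s ∈ Icc 0 (ℓ i), γ i s = x := by
    intro x
    obtain ⟨⟨i, s⟩, rfl⟩ := hπ x
    exact ⟨i, s, s.2, by simp only [γ, projIcc_val]⟩
  refine ⟨R, inferInstance, γ, isRTree_of_fourPoint ?_ ?_, hsurj, hγ⟩
  · intro u v
    obtain ⟨i, s, hs, rfl⟩ := hsurj u
    obtain ⟨j, t, ht, rfl⟩ := hsurj v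
    have huv := hγ i s hs j t ht
    set k := min (min s t) (G i j) with hk
    have hks : k ≤ s := (min_le_left _ _).trans (min_le_left _ _)
    have hkt : k ≤ t := (min_le_left _ _).trans (min_le_right _ _)
    have hkG : k ≤ G i j := min_le_right _ _
    have hk0 : 0 ≤ k := le_min (le_min hs.1 ht.1) (hG0 i j)
    have hcross : ∀ s' t', k ≤ s' → s' ≤ s → k ≤ t' → t' ≤ t →
        dist (γ i s') (γ j t') = s' + t' - 2 * k := by
      intro s' t' h1 h2 h3 h4
      rw [hγ i s' ⟨by linarith, by linarith [hs.2]⟩ j t' ⟨by linarith, by linarith [ht.2]⟩]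
      have : min (min s' t') (G i j) = k := by
        refine le_antisymm ?_ (le_min (le_min h1 h3) hkG)
        exact min_le_min (min_le_min h2 h4) le_rfl
      rw [this]
    have hsame : ∀ i, ∀ a ∈ Icc 0 (ℓ i), ∀ b ∈ Icc 0 (ℓ i), dist (γ i a) (γ i b) = |a - b| := by
      intro i a ha b hb
      rw [hγ i a ha i b hb, hGself, min_eq_left ((min_le_left _ _).trans ha.2),
        add_sub_two_mul_min]
    refine ⟨fun τ => if τ ≤ s - k then γ i (s - τ) else γ j (τ - s + 2 * k), ?_, ?_, ?_⟩
    · simp [hks]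
    · rw [huv]
      dsimp only
      split_ifs with h
      · refine dist_le_zero.1 ?_
        rw [hcross _ _ (by linarith) (by linarith) hkt le_rfl]
        linarith
      · congr 1; ring
    · rw [huv]
      intro a ha b hb
      dsimp only
      obtain ⟨ha0, ha1⟩ := ha
      obtain ⟨hb0, hb1⟩ := hb
      obtain ⟨hs0, hs1⟩ := hs
      obtain ⟨ht0, ht1⟩ := ht
      split_ifs with h1 h2 h2
      · rw [hsame i _ ⟨by linarith, by linarith⟩ _ ⟨by linarith, by linarith⟩, abs_sub_comm]
        congr 1; ring
      · rw [hcross _ _ (by linarith) (by linarith) (by linarith) (by linarith),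
          abs_of_nonpos (by linarith)]
        ring
      · rw [dist_comm, hcross _ _ (by linarith) (by linarith) (by linarith) (by linarith),
          abs_of_nonneg (by linarith)]
        ring
      · rw [hsame j _ ⟨by linarith, by linarith⟩ _ ⟨by linarith, by linarith⟩]
        congr 1; ring
  · intro x y z w
    obtain ⟨x, rfl⟩ := hπ x
    obtain ⟨y, rfl⟩ := hπ y
    obtain ⟨z, rfl⟩ := hπ z
    obtain ⟨w, rfl⟩ := hπ w
    simp only [hd]
    rcases min_le_iff.1 (min_add_le_of_ultrametric hKcomm hK x y z w) with h | h
    · exact le_max_of_le_left (by linarith)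
    · exact le_max_of_le_right (by linarith)

/-- Existence of the cut-tree: if every finite restriction of a distance matrix `D`
(a metric on `ℕ`, with `0` the root) is realized by points spanning an `ℝ`-tree, then
the whole matrix is realized by a countable family of points spanning an `ℝ`-tree. -/
theorem rTree_spanned_exists (D : ℕ → ℕ → ℝ)
    (hDzero : ∀ i, D i i = 0) (hDsep : ∀ i j, D i j = 0 → i = j)
    (hDsymm : ∀ i j, D i j = D j i) (hDtri : ∀ i j k, D i k ≤ D i j + D j k)
    (hfin : ∀ n : ℕ, 1 ≤ n → ∃ (Rn : Type) (_ : MetricSpace Rn) (xs : ℕ → Rn),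
      IsRTree Rn ∧ (∀ i ≤ n, ∀ j ≤ n, dist (xs i) (xs j) = D i j) ∧
      (⋃ i ∈ Finset.Icc 1 n, rSeg (xs 0) (xs i)) = univ) :
    ∃ (R : Type) (_ : MetricSpace R) (x : ℕ → R),
      IsRTree R ∧ (∀ i j, dist (x i) (x j) = D i j) ∧
      (⋃ i ∈ {i : ℕ | 1 ≤ i}, rSeg (x 0) (x i)) = univ := by
  have hnn : ∀ i j, 0 ≤ D i j := fun i j => by
    linarith [hDtri i j i, hDzero i, hDsymm i j]
  obtain ⟨R, _, γ, hR, hsurj, hγ⟩ := exists_glued_segments (D 0)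
    (fun i j => (D 0 i + D 0 j - D i j) / 2) (hnn 0)
    (fun i j => by linarith [hDtri i 0 j, hDsymm i 0]) (fun i => by rw [hDzero]; ring)
    (fun i j => by rw [hDsymm i j]; ring)
    (fun i j k => by
      obtain ⟨T, _, xs, hT, hxs, -⟩ := hfin (i + j + k + 1) (by omega)
      have h := hT.min_gromovProduct_le (xs 0) (xs i) (xs j) (xs k)
      rw [hxs 0 (by omega) i (by omega), hxs 0 (by omega) j (by omega),
        hxs 0 (by omega) k (by omega), hxs i (by omega) j (by omega),
        hxs j (by omega) k (by omega), hxs i (by omega) k (by omega)] at h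
      rcases min_le_iff.1 h with h | h
      · exact min_le_of_left_le (by linarith)
      · exact min_le_of_right_le (by linarith))
  have hdist : ∀ i j, dist (γ i (D 0 i)) (γ j (D 0 j)) = D i j := by
    intro i j
    rw [hγ i _ ⟨hnn 0 i, le_rfl⟩ j _ ⟨hnn 0 j, le_rfl⟩, min_eq_right]
    · ring
    · refine le_min ?_ ?_
      · linarith [hDtri 0 i j]
      · linarith [hDtri 0 j i, hDsymm i j]
  have hseg : ∀ i, IsSegParam (γ 0 (D 0 0)) (γ i (D 0 i)) (γ i) := by
    intro i
    refine ⟨?_, by rw [hdist], ?_⟩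
    · refine dist_le_zero.1 ?_
      rw [hγ i 0 ⟨le_rfl, hnn 0 i⟩ 0 _ ⟨hnn 0 0, le_rfl⟩]
      simp [hDzero, hDsymm i 0]
    · rw [hdist]
      intro s hs t ht
      rw [hγ i s hs i t ht, hDzero, min_eq_left (by linarith [min_le_left s t, hs.2]),
        add_sub_two_mul_min]
  refine ⟨R, inferInstance, fun i => γ i (D 0 i), hR, hdist, eq_univ_of_forall fun x => ?_⟩
  obtain ⟨i, s, hs, rfl⟩ := hsurj x
  simp only [mem_iUnion, mem_ofPred_eq, exists_prop]
  rcases Nat.eq_zero_or_pos i with rfl | hi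
  · have hs0 : s = D 0 0 := le_antisymm hs.2 (by rw [hDzero]; exact hs.1)
    exact ⟨1, le_rfl, γ 1, hseg 1, 0, ⟨le_rfl, dist_nonneg⟩, by rw [(hseg 1).1, hs0]⟩
  · exact ⟨i, hi, γ i, hseg i, s, by rwa [hdist], rfl⟩
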